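/- Let X be a random variable with density f belonging to the integrated Pearson family IP(μ; δ, β, γ) with δ ≤ 0, let m ≥ 1 be an integer, and let g ∈ H^{m,0}(X). Then Var[g(X)] ≥ Σ_{i=1}^{m} (E[q(X)^i g^{(i)}(X)])² / (i! · E[q(X)^i] · ∏_{j=i−1}^{2i−2}(1−jδ)). -/

import Mathlib

open MeasureTheory ProbabilityTheory Finset Filter

noncomputable section

/-- Falling factorial `(x)_k = x (x-1) ⋯ (x-k+1)`, with `(x)_0 = 1`. -/
def fall (x : ℝ) (k : ℕ) : ℝ := ∏ j ∈ Finset.range k, (x - j)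

/-- Rising factorial `[x]_k = x (x+1) ⋯ (x+k-1)`, with `[x]_0 = 1`. -/
def rise (x : ℝ) (k : ℕ) : ℝ := ∏ j ∈ Finset.range k, (x + j)

/-- The product `∏_{j=a}^{a+len-1} (1 - j δ)` of `len` consecutive factors
(an empty product is `1`). -/
def pp (δ a : ℝ) (len : ℕ) : ℝ := ∏ j ∈ Finset.range len, (1 - (a + j) * δ)

/-- The open real interval with (possibly infinite) endpoints `α ω : EReal`. -/
def erealIoo (α ω : EReal) : Set ℝ := {x : ℝ | α < (x : EReal) ∧ (x : EReal) < ω}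

/-- `g` coincides on `J` with a polynomial of degree at most `d`. -/
def IsPolyOn (g : ℝ → ℝ) (J : Set ℝ) (d : ℕ) : Prop :=
  ∃ p : Polynomial ℝ, p.natDegree ≤ d ∧ ∀ x ∈ J, g x = p.eval x

/-- The quadratic `q(x) = δ x² + β x + γ` of a Pearson family. -/
def pq (δ β γ : ℝ) : ℝ → ℝ := fun x => δ * x ^ 2 + β * x + γ

/-- `P` is the distribution of a random variable with density `f` (w.r.t. Lebesgue
measure) belonging to the integrated Pearson family `IP(μ; δ, β, γ)`:
`μ` is the (finite) mean of `P`, `|δ|+|β|+|γ| > 0`, and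
`∫_{-∞}^x (μ - t) f(t) dt = q(x) f(x)` for all `x`. -/
def IsIntegratedPearson (P : Measure ℝ) (f : ℝ → ℝ) (μ δ β γ : ℝ) : Prop :=
  IsProbabilityMeasure P ∧
  (∀ x, 0 ≤ f x) ∧
  P = volume.withDensity (fun x => ENNReal.ofReal (f x)) ∧
  Integrable (fun x : ℝ => x) P ∧
  μ = ∫ x, x ∂P ∧
  0 < |δ| + |β| + |γ| ∧
  ∀ x : ℝ, (∫ t in Set.Iic x, (μ - t) * f t) = pq δ β γ x * f x

/-- Membership in the class `H^{m,n}(X)` for the distribution `P` of `X` with Pearson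
quadratic `q` and support `J`.  Here `gd k` plays the role of the `k`-th derivative
`g^{(k)}` of `g = gd 0` on `J`.  With `ℓ = max m n`:  `g ∈ C^{ℓ-1}(J)`
(encoded by `gd k` having derivative `gd (k+1)` at every point of `J` for `k+1 < ℓ`,
and `gd (ℓ-1)` continuous on `J`), `g^{(ℓ-1)}` is absolutely continuous on `J` with
a.e. derivative `g^{(ℓ)} = gd ℓ` (encoded by the fundamental theorem of calculus:
`gd ℓ` is locally integrable and `gd (ℓ-1)` is its integral on every subinterval of `J`),
and the moment conditions `E[q(X)^n (g^{(n)}(X))²] < ∞` and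
`E[q(X)^i |g^{(i)}(X)|] < ∞` for `n < i ≤ m` hold. -/
def MemH (P : Measure ℝ) (q : ℝ → ℝ) (J : Set ℝ) (m n : ℕ) (gd : ℕ → ℝ → ℝ) : Prop :=
  (∀ k, k + 1 < max m n → ∀ x ∈ J, HasDerivAt (gd k) (gd (k + 1) x) x) ∧
  (1 ≤ max m n → ContinuousOn (gd (max m n - 1)) J) ∧
  (1 ≤ max m n → ∀ a ∈ J, ∀ b ∈ J,
    IntervalIntegrable (gd (max m n)) volume a b ∧
      gd (max m n - 1) b - gd (max m n - 1) a = ∫ t in a..b, gd (max m n) t) ∧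
  Integrable (fun x => q x ^ n * (gd n x) ^ 2) P ∧
  ∀ i, n < i → i ≤ m → Integrable (fun x => q x ^ i * |gd i x|) P

/-- The variance bound `S_{m,n}(g)` of Theorem 2.1, for a Pearson distribution `P`
with quadratic `q` and parameter `δ`. -/
def Sbound (P : Measure ℝ) (δ : ℝ) (q : ℝ → ℝ) (m n : ℕ) (gd : ℕ → ℝ → ℝ) : ℝ :=
  (∑ i ∈ Finset.Icc 1 m,
      ((m.choose i : ℝ) * pp δ ((m : ℝ) + i) n /
          (fall ((m : ℝ) + n) i * (∫ x, q x ^ i ∂P) * pp δ ((i : ℝ) - 1) i *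
            pp δ (m : ℝ) n)) *
        (∫ x, q x ^ i * gd i x ∂P) ^ 2) +
    ∑ i ∈ Finset.Icc 1 n,
      (-1 : ℝ) ^ (i - 1) *
          ((n.choose i : ℝ) / (fall ((m : ℝ) + n) i * pp δ (m : ℝ) i)) *
        ∫ x, q x ^ i * (gd i x) ^ 2 ∂P


/-! ### Absolutely continuous pairs -/

/-- The first function is an indefinite integral of the second on the set. -/
structure ACP (J : Set ℝ) (h h' : ℝ → ℝ) : Prop where
  ftc : ∀ a ∈ J, ∀ b ∈ J, IntervalIntegrable h' volume a b ∧ h b - h a = ∫ t in a..b, h' t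

theorem ACP.of_hasDerivAt {J : Set ℝ} (hJ : J.OrdConnected) {h h' : ℝ → ℝ}
    (hd : ∀ x ∈ J, HasDerivAt h (h' x) x) (hc : ContinuousOn h' J) : ACP J h h' := by
  refine ⟨fun a ha b hb => ?_⟩
  have hsub : Set.uIcc a b ⊆ J := hJ.uIcc_subset ha hb
  have hi : IntervalIntegrable h' volume a b := (hc.mono hsub).intervalIntegrable
  exact ⟨hi, (intervalIntegral.integral_eq_sub_of_hasDerivAt (fun x hx => hd x (hsub hx)) hi).symm⟩

theorem ACP.continuousOn {J : Set ℝ} (hJo : IsOpen J) (hJ : J.OrdConnected) {h h' : ℝ → ℝ}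
    (H : ACP J h h') : ContinuousOn h J := by
  intro x hx
  apply ContinuousAt.continuousWithinAt
  obtain ⟨ε, hε, hsub⟩ := Metric.isOpen_iff.1 hJo x hx
  have h1 : x - ε / 2 ∈ J := hsub (by simp [abs_of_pos hε]; linarith)
  have h2 : x + ε / 2 ∈ J := hsub (by simp [abs_of_pos hε]; linarith)
  have hi := (H.ftc _ h1 _ h2).1
  have hc := intervalIntegral.continuousOn_primitive_interval' hi (a := x - ε / 2) (by simp)
  have hc2 : ContinuousOn h (Set.uIcc (x - ε / 2) (x + ε / 2)) := by
    have : ContinuousOn (fun y => h (x - ε / 2) + ∫ t in (x - ε / 2)..y, h' t)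
        (Set.uIcc (x - ε / 2) (x + ε / 2)) := continuousOn_const.add hc
    refine this.congr ?_
    intro y hy
    have := (H.ftc _ h1 y (hJ.uIcc_subset h1 h2 hy)).2
    simp only
    linarith
  apply hc2.continuousAt
  rw [Set.uIcc_of_le (by linarith)]
  exact Icc_mem_nhds (by linarith) (by linarith)

theorem ACP.aesm {J : Set ℝ} (hJo : IsOpen J) {h h' : ℝ → ℝ}
    (H : ACP J h h') : AEStronglyMeasurable h' (volume.restrict J) := by
  apply LocallyIntegrableOn.aestronglyMeasurable
  intro x hx
  obtain ⟨ε, hε, hsub⟩ := Metric.isOpen_iff.1 hJo x hx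
  have h1 : x - ε / 2 ∈ J := hsub (by simp [abs_of_pos hε]; linarith)
  have h2 : x + ε / 2 ∈ J := hsub (by simp [abs_of_pos hε]; linarith)
  have hi := (H.ftc _ h1 _ h2).1
  rw [intervalIntegrable_iff_integrableOn_Icc_of_le (by linarith)] at hi
  exact ⟨_, mem_nhdsWithin_of_mem_nhds (Icc_mem_nhds (by linarith) (by linarith)), hi⟩

theorem ACP.mul {J : Set ℝ} (hJo : IsOpen J) (hJ : J.OrdConnected) {u u' v v' : ℝ → ℝ}
    (U : ACP J u u') (V : ACP J v v') :
    ACP J (fun x => u x * v x) (fun x => u' x * v x + u x * v' x) := by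
  refine ⟨fun a ha b hb => ?_⟩
  have hsub : Set.uIcc a b ⊆ J := hJ.uIcc_subset ha hb
  obtain ⟨hui, -⟩ := U.ftc a ha b hb
  obtain ⟨hvi, -⟩ := V.ftc a ha b hb
  have huc := (U.continuousOn hJo hJ).mono hsub
  have hvc := (V.continuousOn hJo hJ).mono hsub
  refine ⟨(hui.mul_continuousOn hvc).add (hvi.continuousOn_mul huc), ?_⟩
  have e1 : ∀ x ∈ Set.uIcc a b, u x = u a + ∫ t in a..x, u' t := fun x hx => by
    have := (U.ftc a ha x (hsub hx)).2; linarith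
  have e2 : ∀ x ∈ Set.uIcc a b, v x = v a + ∫ t in a..x, v' t := fun x hx => by
    have := (V.ftc a ha x (hsub hx)).2; linarith
  have hcst : ∀ k : ℝ, AbsolutelyContinuousOnInterval (fun _ => k) a b := fun k => by
    have := (LipschitzWith.const k).lipschitzOnWith (s := Set.uIcc a b)
    exact this.absolutelyContinuousOnInterval
  have acu : AbsolutelyContinuousOnInterval (fun x => u a + ∫ t in a..x, u' t) a b :=
    (hcst (u a)).add (hui.absolutelyContinuousOnInterval_intervalIntegral (c := a) (by simp))
  have acv : AbsolutelyContinuousOnInterval (fun x => v a + ∫ t in a..x, v' t) a b :=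
    (hcst (v a)).add (hvi.absolutelyContinuousOnInterval_intervalIntegral (c := a) (by simp))
  have key := acu.integral_deriv_mul_eq_sub acv
  rw [← e1 b (by simp), ← e1 a (by simp), ← e2 b (by simp), ← e2 a (by simp)] at key
  rw [← key]
  apply intervalIntegral.integral_congr_ae
  filter_upwards [hui.ae_hasDerivAt_integral, hvi.ae_hasDerivAt_integral] with x hx1 hx2 hx3
  have hx4 : x ∈ Set.uIcc a b := Set.uIoc_subset_uIcc hx3
  rw [((hx1 hx4 a (by simp)).const_add (u a)).deriv, ((hx2 hx4 a (by simp)).const_add (v a)).deriv,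
    ← e1 x hx4, ← e2 x hx4]

/-- Weighted Pearson-type identity, `L x = a - b x`. -/
structure GP (J : Set ℝ) (q w : ℝ → ℝ) (a b : ℝ) : Prop where
  hb : 0 < b
  wpos : ∀ x ∈ J, 0 < w x
  wzero : ∀ x ∉ J, w x = 0
  int0 : Integrable w
  int1 : Integrable (fun x => x * w x)
  tot : ∫ x, (a - b * x) * w x = 0
  iic : ∀ x, ∫ t in Set.Iic x, (a - b * t) * w t = q x * w x

theorem GP.intL {J : Set ℝ} {q w : ℝ → ℝ} {a b : ℝ} (G : GP J q w a b) :
    Integrable (fun x => (a - b * x) * w x) := by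
  have := (G.int0.const_mul a).sub (G.int1.const_mul b)
  refine this.congr (Eventually.of_forall fun x => ?_)
  simp only [Pi.sub_apply]; ring

theorem GP.wnn {J : Set ℝ} {q w : ℝ → ℝ} {a b : ℝ} (G : GP J q w a b) (x : ℝ) : 0 ≤ w x := by
  by_cases hx : x ∈ J
  · exact (G.wpos x hx).le
  · rw [G.wzero x hx]

theorem GP.root {J : Set ℝ} (hJo : IsOpen J) (hJ : J.OrdConnected) (hne : J.Nonempty)
    {q w : ℝ → ℝ} {a b : ℝ} (G : GP J q w a b) : a / b ∈ J := by
  by_contra hc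
  have hb := G.hb
  have hpos : 0 < volume J := hJo.measure_pos volume hne
  have key : ∀ s : ℝ, (∀ x, 0 ≤ s * ((a - b * x) * w x)) → s ≠ 0 → False := by
    intro s hs hs0
    have hi := G.intL.const_mul s
    have h0 : ∫ x, s * ((a - b * x) * w x) = 0 := by
      rw [integral_const_mul, G.tot, mul_zero]
    rw [integral_eq_zero_iff_of_nonneg hs hi] at h0
    have hnull : volume {x | ¬ (s * ((a - b * x) * w x) = 0)} = 0 := h0
    apply hpos.ne'
    refine measure_mono_null ?_ hnull
    intro x hx
    have hw := G.wpos x hx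
    have hxl : a - b * x ≠ 0 := by
      intro h
      apply hc
      have : a / b = x := by field_simp; linarith
      rwa [this]
    exact mul_ne_zero hs0 (mul_ne_zero hxl hw.ne')
  have hside : (∀ x ∈ J, x < a / b) ∨ (∀ x ∈ J, a / b < x) := by
    by_contra hcon
    push Not at hcon
    obtain ⟨⟨x, hx, hx1⟩, ⟨y, hy, hy1⟩⟩ := hcon
    exact hc (hJ.out hy hx ⟨hy1, hx1⟩)
  rcases hside with h | h
  · apply key 1 _ one_ne_zero
    intro x
    by_cases hx : x ∈ J
    · have := (lt_div_iff₀ hb).1 (h x hx)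
      have := mul_nonneg (show 0 ≤ a - b * x by linarith) (G.wnn x)
      linarith
    · simp [G.wzero x hx]
  · apply key (-1) _ (by norm_num)
    intro x
    by_cases hx : x ∈ J
    · have := (div_lt_iff₀ hb).1 (h x hx)
      have := mul_nonneg (show 0 ≤ -(a - b * x) by linarith) (G.wnn x)
      linarith
    · simp [G.wzero x hx]

theorem GP.key {J : Set ℝ} (hJo : IsOpen J) (hJ : J.OrdConnected) (hne : J.Nonempty)
    {q w : ℝ → ℝ} {a b : ℝ} (G : GP J q w a b) {h h' : ℝ → ℝ} (H : ACP J h h')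
    (hi : Integrable (fun x => q x * w x * h' x)) :
    Integrable (fun x => (a - b * x) * w x * h x) ∧
      ∫ x, q x * w x * h' x = - ∫ x, (a - b * x) * w x * h x := by
  classical
  set c := a / b with hcdef
  have hcJ : c ∈ J := G.root hJo hJ hne
  have hb := G.hb
  have hac : a = b * c := by rw [hcdef]; field_simp
  set l : ℝ → ℝ := fun x => (a - b * x) * w x with hl
  have hlint : Integrable l := G.intL
  set d : ℝ → ℝ := J.indicator h' with hd
  have hdm : AEStronglyMeasurable d volume :=
    (aestronglyMeasurable_indicator_iff hJo.measurableSet).2 (H.aesm hJo)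
  have hwd : ∀ x, q x * w x * h' x = q x * w x * d x := by
    intro x
    by_cases hx : x ∈ J
    · simp [hd, hx]
    · simp [G.wzero x hx]
  let s : ℝ → ℝ → ℝ := fun x t =>
    if c < t then (if t ≤ x then 1 else 0) else (if x < t then -1 else 0)
  let K : ℝ → ℝ → ℝ := fun x t => l x * d t * s x t
  have hKm : AEStronglyMeasurable (Function.uncurry K) (volume.prod volume) := by
    have hs : Measurable (Function.uncurry s) := by
      refine Measurable.ite (measurableSet_lt measurable_const measurable_snd) ?_ ?_
      · exact Measurable.ite (measurableSet_le measurable_snd measurable_fst)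
          measurable_const measurable_const
      · exact Measurable.ite (measurableSet_lt measurable_fst measurable_snd)
          measurable_const measurable_const
    exact (hlint.aestronglyMeasurable.comp_fst.mul hdm.comp_snd).mul hs.aestronglyMeasurable
  have hIio : ∀ t, ∫ x in Set.Iio t, l x = q t * w t := fun t => by
    rw [← integral_Iic_eq_integral_Iio]; exact G.iic t
  have hIci : ∀ t, ∫ x in Set.Ici t, l x = - (q t * w t) := fun t => by
    have := integral_add_compl (measurableSet_Iio (a := t)) hlint
    rw [Set.compl_Iio, hIio, G.tot] at this
    linarith
  have hlneg : ∀ x, c < x → l x ≤ 0 := fun x hx =>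
    mul_nonpos_of_nonpos_of_nonneg (by rw [hac]; nlinarith) (G.wnn x)
  have hlpos : ∀ x, x < c → 0 ≤ l x := fun x hx =>
    mul_nonneg (by rw [hac]; nlinarith) (G.wnn x)
  have sec : ∀ t, Integrable (fun x => K x t) ∧ ∫ x, K x t = - (q t * w t * d t) ∧
      ∫ x, ‖K x t‖ = ‖q t * w t * d t‖ := by
    intro t
    by_cases hct : c < t
    · have e : (fun x => K x t) = fun x => d t * (Set.Ici t).indicator l x := by
        funext x
        by_cases hx : t ≤ x
        · simp [K, s, hct, hx]; ring
        · simp [K, s, hct, hx]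
      have en : (fun x => ‖K x t‖) = fun x => |d t| * (-(Set.Ici t).indicator l x) := by
        funext x
        rw [congrFun e x, norm_mul, Real.norm_eq_abs, Real.norm_eq_abs]
        congr 1
        apply abs_of_nonpos
        apply Set.indicator_nonpos
        intro y hy
        exact hlneg y (lt_of_lt_of_le hct hy)
      have hint := hlint.indicator (measurableSet_Ici (a := t))
      have hI : ∫ x, (Set.Ici t).indicator l x = -(q t * w t) := by
        rw [integral_indicator measurableSet_Ici, hIci]
      have hW : 0 ≤ q t * w t := by
        have : ∫ x, (Set.Ici t).indicator l x ≤ 0 := by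
          apply integral_nonpos
          intro x
          apply Set.indicator_nonpos
          intro y hy
          exact hlneg y (lt_of_lt_of_le hct hy)
        linarith
      refine ⟨e ▸ hint.const_mul _, ?_, ?_⟩
      · rw [e, integral_const_mul, hI]; ring
      · rw [en, integral_const_mul, integral_neg, hI, norm_mul, Real.norm_of_nonneg hW,
          Real.norm_eq_abs]; ring
    · have e : (fun x => K x t) = fun x => -(d t) * (Set.Iio t).indicator l x := by
        funext x
        by_cases hx : x < t
        · simp [K, s, hct, hx]; ring
        · simp [K, s, hct, hx]
      have hnn : ∀ x, 0 ≤ (Set.Iio t).indicator l x := fun x => by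
        apply Set.indicator_nonneg
        intro y hy
        exact hlpos y (lt_of_lt_of_le hy (not_lt.1 hct))
      have en : (fun x => ‖K x t‖) = fun x => |d t| * ((Set.Iio t).indicator l x) := by
        funext x
        rw [congrFun e x, norm_mul, Real.norm_eq_abs, Real.norm_eq_abs, abs_neg,
          abs_of_nonneg (hnn x)]
      have hint := hlint.indicator (measurableSet_Iio (a := t))
      have hI : ∫ x, (Set.Iio t).indicator l x = q t * w t := by
        rw [integral_indicator measurableSet_Iio, hIio]
      have hW : 0 ≤ q t * w t := hI ▸ integral_nonneg hnn
      refine ⟨e ▸ hint.const_mul _, ?_, ?_⟩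
      · rw [e, integral_const_mul, hI]; ring
      · rw [en, integral_const_mul, hI, norm_mul, Real.norm_of_nonneg hW,
          Real.norm_eq_abs]; ring
  have hKi : Integrable (Function.uncurry K) (volume.prod volume) := by
    rw [integrable_prod_iff' hKm]
    refine ⟨Eventually.of_forall fun t => (sec t).1, ?_⟩
    have : (fun y => ∫ x, ‖Function.uncurry K (x, y)‖) = fun t => ‖q t * w t * h' t‖ := by
      funext t
      rw [hwd]
      exact (sec t).2.2
    rw [this]
    exact hi.norm
  have sect : ∀ x, ∫ t, K x t = l x * (h x - h c) := by
    intro x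
    by_cases hx : x ∈ J
    · have e : (fun t => K x t) =
          fun t => l x * ((Set.Ioc c x).indicator d t - (Set.Ioc x c).indicator d t) := by
        funext t
        simp only [K, s, Set.indicator, Set.mem_Ioc, mul_assoc]
        congr 1
        split_ifs <;> first | (exfalso; grind) | simp
      have hii : IntervalIntegrable d volume c x := by
        refine (H.ftc c hcJ x hx).1.congr ?_
        intro t ht
        have : t ∈ J := hJ.uIcc_subset hcJ hx (Set.uIoc_subset_uIcc ht)
        simp [hd, this]
      rw [e, integral_const_mul, integral_sub, integral_indicator measurableSet_Ioc,
        integral_indicator measurableSet_Ioc]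
      · congr 1
        change ∫ t in c..x, d t = _
        rw [(H.ftc c hcJ x hx).2]
        apply intervalIntegral.integral_congr
        intro t ht
        have : t ∈ J := hJ.uIcc_subset hcJ hx ht
        simp [hd, this]
      · exact (integrable_indicator_iff measurableSet_Ioc).2 hii.1
      · exact (integrable_indicator_iff measurableSet_Ioc).2 hii.2
    · have : l x = 0 := by simp [hl, G.wzero x hx]
      simp [K, this]
  have hA : Integrable (fun x => l x * (h x - h c)) := by
    have := hKi.integral_prod_left
    refine this.congr (Eventually.of_forall fun x => ?_)
    exact sect x
  have hB : ∫ x, l x * (h x - h c) = - ∫ t, q t * w t * h' t := by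
    have h1 := integral_integral_swap hKi
    simp_rw [sect] at h1
    rw [h1, ← integral_neg]
    congr 1
    funext t
    rw [(sec t).2.1, hwd]
  have hC : Integrable (fun x => l x * h x) := by
    have := hA.add (hlint.mul_const (h c))
    refine this.congr (Eventually.of_forall fun x => ?_)
    simp only [Pi.add_apply]; ring
  refine ⟨hC, ?_⟩
  have hD : ∫ x, l x * (h x - h c) = ∫ x, l x * h x := by
    have : (fun x => l x * (h x - h c)) = fun x => l x * h x - l x * h c := by
      funext x; ring
    rw [this, integral_sub hC (hlint.mul_const _), integral_mul_const]
    have : ∫ x, l x = 0 := G.tot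
    rw [this]; ring
  linarith

/-! ### Moments and iteration -/

theorem pq_cont (δ β γ : ℝ) : Continuous (pq δ β γ) := by
  unfold pq; fun_prop

theorem pq_hasDeriv (δ β γ x : ℝ) : HasDerivAt (pq δ β γ) (2 * δ * x + β) x := by
  unfold pq
  have h := (((hasDerivAt_id x).pow 2).const_mul δ).add (((hasDerivAt_id x).const_mul β))
  have h2 := h.add_const γ
  refine (h2.congr_deriv ?_)
  simp; ring

theorem int_q_mul {δ β γ : ℝ} (hδ : δ ≤ 0) {J : Set ℝ} (hq : ∀ x ∈ J, 0 < pq δ β γ x)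
    {u : ℝ → ℝ} (hu0 : ∀ x ∉ J, u x = 0) (hu : Integrable u)
    (hxu : Integrable (fun x => x * u x)) : Integrable (fun x => pq δ β γ x * u x) := by
  have hdom := ((hu.norm.const_mul |γ|).add (hxu.norm.const_mul |β|))
  refine hdom.mono' ((pq_cont δ β γ).aestronglyMeasurable.mul hu.aestronglyMeasurable) ?_
  refine Eventually.of_forall fun x => ?_
  simp only [Pi.add_apply, norm_mul, Real.norm_eq_abs]
  by_cases hx : x ∈ J
  · have h1 := hq x hx
    rw [abs_of_pos h1]
    have h2 : pq δ β γ x ≤ |γ| + |β| * |x| := by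
      have e1 := le_abs_self γ
      have e2 := le_abs_self (β * x)
      rw [abs_mul] at e2
      have e3 : δ * x ^ 2 ≤ 0 := mul_nonpos_of_nonpos_of_nonneg hδ (sq_nonneg x)
      unfold pq
      linarith
    have := mul_le_mul_of_nonneg_right h2 (abs_nonneg (u x))
    nlinarith
  · simp [hu0 x hx]

theorem GP.moments {δ β γ : ℝ} (hδ : δ ≤ 0) {J : Set ℝ} (hJo : IsOpen J) (hJ : J.OrdConnected)
    (hne : J.Nonempty) (hq : ∀ x ∈ J, 0 < pq δ β γ x) {w : ℝ → ℝ} {a b : ℝ}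
    (G : GP J (pq δ β γ) w a b) (d : ℕ) : Integrable (fun x => x ^ d * w x) := by
  have main : ∀ d : ℕ, Integrable (fun x => x ^ d * w x) ∧
      Integrable (fun x => x ^ (d + 1) * w x) := by
    intro d
    induction d with
    | zero => exact ⟨by simpa using G.int0, by simpa using G.int1⟩
    | succ d ih =>
      refine ⟨ih.2, ?_⟩
      have hac : ACP J (fun x => x ^ (d + 1)) (fun x => ((d : ℝ) + 1) * x ^ d) := by
        refine ACP.of_hasDerivAt hJ (fun x _ => ?_) (by fun_prop)
        have := hasDerivAt_pow (d + 1) x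
        simpa using this
      have hu : Integrable (fun x => pq δ β γ x * (((d : ℝ) + 1) * (x ^ d * w x))) := by
        refine int_q_mul hδ hq (fun x hx => by simp [G.wzero x hx]) (ih.1.const_mul _) ?_
        refine (ih.2.const_mul ((d : ℝ) + 1)).congr (Eventually.of_forall fun x => ?_)
        simp only; ring
      have hk := (G.key hJo hJ hne hac (hu.congr (Eventually.of_forall fun x => by
        simp only; ring))).1
      have hb := G.hb
      refine (((ih.2.const_mul a).sub hk).const_mul b⁻¹).congr (Eventually.of_forall fun x => ?_)
      simp only [Pi.sub_apply]
      field_simp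
      ring
  exact (main d).1

theorem int_poly {w : ℝ → ℝ} {n : ℕ} (hw : ∀ d ≤ n, Integrable (fun x : ℝ => x ^ d * w x))
    (p : Polynomial ℝ) (hp : p.natDegree ≤ n) : Integrable (fun x => p.eval x * w x) := by
  have e : (fun x => p.eval x * w x) =
      fun x => ∑ i ∈ Finset.range (p.natDegree + 1), p.coeff i * (x ^ i * w x) := by
    funext x
    rw [Polynomial.eval_eq_sum_range, Finset.sum_mul]
    exact Finset.sum_congr rfl fun i _ => by ring
  rw [e]
  refine integrable_finsetSum _ fun i hi => (hw i ?_).const_mul _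
  have := Finset.mem_range.1 hi
  omega

/-- The Pearson quadratic as a polynomial. -/
def Qp (δ β γ : ℝ) : Polynomial ℝ :=
  Polynomial.C δ * Polynomial.X ^ 2 + Polynomial.C β * Polynomial.X + Polynomial.C γ

theorem Qp_eval (δ β γ x : ℝ) : (Qp δ β γ).eval x = pq δ β γ x := by
  simp [Qp, pq]

theorem GP.step {δ β γ : ℝ} (hδ : δ ≤ 0) {J : Set ℝ} (hJo : IsOpen J) (hJ : J.OrdConnected)
    (hne : J.Nonempty) (hq : ∀ x ∈ J, 0 < pq δ β γ x) {w : ℝ → ℝ} {a b : ℝ}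
    (G : GP J (pq δ β γ) w a b) :
    GP J (pq δ β γ) (fun x => pq δ β γ x * w x) (a + β) (b - 2 * δ) := by
  have hM := G.moments hδ hJo hJ hne hq
  have hP : ∀ p : Polynomial ℝ, Integrable (fun x => p.eval x * w x) := fun p =>
    int_poly (n := p.natDegree) (fun d _ => hM d) p le_rfl
  have hd : ∀ x, HasDerivAt (pq δ β γ) (2 * δ * x + β) x := pq_hasDeriv δ β γ
  have hqq : Integrable (fun x => pq δ β γ x * w x * (2 * δ * x + β)) := by
    refine (hP (Qp δ β γ * (Polynomial.C (2 * δ) * Polynomial.X + Polynomial.C β))).congr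
      (Eventually.of_forall fun x => ?_)
    simp [Qp_eval]; ring
  have hLq : Integrable (fun x => (a - b * x) * w x * pq δ β γ x) := by
    refine (hP (Qp δ β γ * (Polynomial.C a - Polynomial.C b * Polynomial.X))).congr
      (Eventually.of_forall fun x => ?_)
    simp [Qp_eval]; ring
  refine ⟨by linarith [G.hb], fun x hx => mul_pos (hq x hx) (G.wpos x hx),
    fun x hx => by simp [G.wzero x hx], ?_, ?_, ?_, ?_⟩
  · refine (hP (Qp δ β γ)).congr (Eventually.of_forall fun x => ?_)
    simp [Qp_eval]
  · refine (hP (Polynomial.X * Qp δ β γ)).congr (Eventually.of_forall fun x => ?_)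
    simp [Qp_eval]; ring
  · have hac : ACP J (pq δ β γ) (fun x => 2 * δ * x + β) :=
      ACP.of_hasDerivAt hJ (fun x _ => hd x) (by fun_prop)
    have hk := (G.key hJo hJ hne hac hqq).2
    have e : (fun x => (a + β - (b - 2 * δ) * x) * (pq δ β γ x * w x)) =
        fun x => pq δ β γ x * w x * (2 * δ * x + β) + (a - b * x) * w x * pq δ β γ x := by
      funext x; ring
    rw [e, integral_add hqq hLq, hk]; ring
  · intro x
    have hac : ACP J (fun y => pq δ β γ (min y x) - pq δ β γ x)
        ((Set.Iic x).indicator (fun y => 2 * δ * y + β)) := by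
      refine ⟨fun s _ t _ => ?_⟩
      have hii : IntervalIntegrable ((Set.Iic x).indicator (fun y => 2 * δ * y + β)) volume s t := by
        have : IntervalIntegrable (fun y => 2 * δ * y + β) volume s t :=
          Continuous.intervalIntegrable (by fun_prop) _ _
        exact ⟨this.1.indicator measurableSet_Iic, this.2.indicator measurableSet_Iic⟩
      refine ⟨hii, ?_⟩
      symm
      refine integral_eq_of_hasDerivAt_off_countable (fun y => pq δ β γ (min y x) - pq δ β γ x) _
        (Set.countable_singleton x) ?_ ?_ hii
      · have := pq_cont δ β γ
        fun_prop
      · rintro y ⟨-, hy⟩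
        rcases lt_or_gt_of_ne (show y ≠ x from hy) with h | h
        · have e1 : (Set.Iic x).indicator (fun y => 2 * δ * y + β) y = 2 * δ * y + β := by
            simp [h.le]
          rw [e1]
          refine ((hd y).sub_const (pq δ β γ x)).congr_of_eventuallyEq ?_
          filter_upwards [Iio_mem_nhds h] with z hz
          rw [min_eq_left (le_of_lt hz)]
        · have e1 : (Set.Iic x).indicator (fun y => 2 * δ * y + β) y = 0 := by
            simp [h]
          rw [e1]
          refine (hasDerivAt_const y (0 : ℝ)).congr_of_eventuallyEq ?_
          filter_upwards [Ioi_mem_nhds h] with z hz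
          rw [min_eq_right (le_of_lt hz), sub_self]
    have e2 : (fun y => pq δ β γ y * w y * (Set.Iic x).indicator (fun y => 2 * δ * y + β) y) =
        (Set.Iic x).indicator (fun y => pq δ β γ y * w y * (2 * δ * y + β)) := by
      funext y
      by_cases hy : y ≤ x
      · simp [hy]
      · simp [hy]
    have e3 : (fun y => (a - b * y) * w y * (pq δ β γ (min y x) - pq δ β γ x)) =
        (Set.Iic x).indicator (fun y => (a - b * y) * w y * pq δ β γ y -
          (a - b * y) * w y * pq δ β γ x) := by
      funext y
      by_cases hy : y ≤ x
      · simp [hy]; ring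
      · simp [hy, min_eq_right (not_le.1 hy).le]
    have hk := (G.key hJo hJ hne hac (e2 ▸ hqq.indicator measurableSet_Iic)).2
    rw [e2, e3, integral_indicator measurableSet_Iic, integral_indicator measurableSet_Iic,
      integral_sub hLq.integrableOn (G.intL.mul_const _).integrableOn, integral_mul_const,
      G.iic] at hk
    have e : (fun x => (a + β - (b - 2 * δ) * x) * (pq δ β γ x * w x)) =
        fun x => pq δ β γ x * w x * (2 * δ * x + β) + (a - b * x) * w x * pq δ β γ x := by
      funext x; ring
    rw [e, integral_add hqq.integrableOn hLq.integrableOn, hk]; ring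

theorem GP.iter {δ β γ : ℝ} (hδ : δ ≤ 0) {J : Set ℝ} (hJo : IsOpen J) (hJ : J.OrdConnected)
    (hne : J.Nonempty) (hq : ∀ x ∈ J, 0 < pq δ β γ x) {f : ℝ → ℝ} {μ : ℝ}
    (G : GP J (pq δ β γ) f μ 1) (k : ℕ) :
    GP J (pq δ β γ) (fun x => pq δ β γ x ^ k * f x) (μ + k * β) (1 - 2 * k * δ) := by
  induction k with
  | zero => simpa using G
  | succ k ih =>
    have := ih.step hδ hJo hJ hne hq
    convert this using 1
    · funext x; ring
    · push_cast; ring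
    · push_cast; ring

theorem intI {δ β γ : ℝ} (hδ : δ ≤ 0) {J : Set ℝ} (hJo : IsOpen J) (hJ : J.OrdConnected)
    (hne : J.Nonempty) (hq : ∀ x ∈ J, 0 < pq δ β γ x) {f : ℝ → ℝ} {μ : ℝ}
    (G : GP J (pq δ β γ) f μ 1) {m : ℕ} {gd : ℕ → ℝ → ℝ}
    (hAC : ∀ k < m, ACP J (gd k) (gd (k + 1)))
    (hI : ∀ k ≤ m, Integrable (fun x => pq δ β γ x ^ k * f x * gd k x)) (d : ℕ) :
    ∀ k, k + d ≤ m → Integrable (fun x => x ^ d * (pq δ β γ x ^ k * f x * gd k x)) := by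
  induction d using Nat.strong_induction_on with
  | _ d ih =>
  intro k hk
  rcases d with _ | d
  · simpa using hI k hk
  have Gk := G.iter hδ hJo hJ hne hq k
  have hac : ACP J (fun x => x ^ d * gd k x)
      (fun x => ((d : ℝ) * x ^ (d - 1)) * gd k x + x ^ d * gd (k + 1) x) := by
    refine ACP.mul hJo hJ (ACP.of_hasDerivAt hJ (fun x _ => hasDerivAt_pow d x) (by fun_prop)) ?_
    exact hAC k (by omega)
  have h0 := ih d (by omega) k (by omega)
  have h1 := ih d (by omega) (k + 1) (by omega)
  have h2 : Integrable (fun x => pq δ β γ x *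
      (((d : ℝ) * x ^ (d - 1)) * (pq δ β γ x ^ k * f x * gd k x))) := by
    rcases d with _ | d
    · simp
    · refine int_q_mul hδ hq (fun x hx => by simp [G.wzero x hx]) ?_ ?_
      · refine ((ih d (by omega) k (by omega)).const_mul ((d + 1 : ℕ) : ℝ)).congr
          (Eventually.of_forall fun x => ?_)
        simp only [Nat.add_sub_cancel]; ring
      · refine (h0.const_mul ((d + 1 : ℕ) : ℝ)).congr
          (Eventually.of_forall fun x => ?_)
        simp only [Nat.add_sub_cancel]; ring
  have hk1 := (Gk.key hJo hJ hne hac ((h2.add h1).congr (Eventually.of_forall fun x => by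
    simp only [Pi.add_apply]; ring))).1
  have hb := Gk.hb
  refine (((h0.const_mul (μ + k * β)).sub hk1).const_mul (1 - 2 * k * δ)⁻¹).congr
    (Eventually.of_forall fun x => ?_)
  simp only [Pi.sub_apply]
  rw [inv_mul_eq_iff_eq_mul₀ hb.ne']
  ring

/-- The linear polynomial of the `k`-th weight. -/
def LinP (μ δ β : ℝ) (k : ℕ) : Polynomial ℝ :=
  Polynomial.C (μ + k * β) - Polynomial.C (1 - 2 * k * δ) * Polynomial.X

/-- The adjoint of differentiation. -/
def Dp (μ δ β γ : ℝ) (k : ℕ) (p : Polynomial ℝ) : Polynomial ℝ :=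
  -(LinP μ δ β k * p + Qp δ β γ * Polynomial.derivative p)

theorem Dp_coeff (μ δ β γ : ℝ) (k : ℕ) (p : Polynomial ℝ) (N : ℕ) :
    (Dp μ δ β γ k p).coeff (N + 1) = -((μ + k * β) * p.coeff (N + 1)
      - (1 - 2 * k * δ) * p.coeff N + δ * (N * p.coeff N)
      + β * ((N + 1) * p.coeff (N + 1)) + γ * ((N + 2) * p.coeff (N + 2))) := by
  have h2 : (Polynomial.X ^ 2 * Polynomial.derivative p).coeff (N + 1) = N * p.coeff N := by
    rw [Polynomial.coeff_X_pow_mul']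
    rcases N with _ | N
    · simp
    · simp [Polynomial.coeff_derivative]; ring
  simp only [Dp, LinP, Qp, Polynomial.coeff_neg, Polynomial.coeff_add, sub_mul, add_mul,
    Polynomial.coeff_sub, mul_assoc, Polynomial.coeff_C_mul, Polynomial.coeff_X_mul, h2,
    Polynomial.coeff_derivative]
  push_cast
  ring

theorem Dp_deg (μ δ β γ : ℝ) (k : ℕ) (p : Polynomial ℝ) (n : ℕ) (hp : p.natDegree ≤ n) :
    (Dp μ δ β γ k p).natDegree ≤ n + 1 ∧
      (Dp μ δ β γ k p).coeff (n + 1) = (1 - (2 * k + n) * δ) * p.coeff n := by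
  have hz := Polynomial.natDegree_le_iff_coeff_eq_zero.1 hp
  constructor
  · rw [Polynomial.natDegree_le_iff_coeff_eq_zero]
    intro N hN
    obtain ⟨M, rfl⟩ : ∃ M, N = M + 1 := ⟨N - 1, by omega⟩
    rw [Dp_coeff, hz M (by omega), hz (M + 1) (by omega), hz (M + 2) (by omega)]
    ring
  · rw [Dp_coeff, hz (n + 1) (by omega), hz (n + 2) (by omega)]
    ring

theorem identI {δ β γ : ℝ} (hδ : δ ≤ 0) {J : Set ℝ} (hJo : IsOpen J) (hJ : J.OrdConnected)
    (hne : J.Nonempty) (hq : ∀ x ∈ J, 0 < pq δ β γ x) {f : ℝ → ℝ} {μ : ℝ}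
    (G : GP J (pq δ β γ) f μ 1) {m : ℕ} {gd : ℕ → ℝ → ℝ}
    (hAC : ∀ k < m, ACP J (gd k) (gd (k + 1)))
    (hI : ∀ k ≤ m, Integrable (fun x => pq δ β γ x ^ k * f x * gd k x))
    (k : ℕ) (p : Polynomial ℝ) (hp : p.natDegree + (k + 1) ≤ m) :
    ∫ x, p.eval x * (pq δ β γ x ^ (k + 1) * f x * gd (k + 1) x) =
      ∫ x, (Dp μ δ β γ k p).eval x * (pq δ β γ x ^ k * f x * gd k x) := by
  have hint := intI hδ hJo hJ hne hq G hAC hI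
  have hpol : ∀ j (r : Polynomial ℝ), r.natDegree + j ≤ m →
      Integrable (fun x => r.eval x * (pq δ β γ x ^ j * f x * gd j x)) := fun j r hr =>
    int_poly (n := r.natDegree) (fun d hd => hint d j (by omega)) r le_rfl
  have Gk := G.iter hδ hJo hJ hne hq k
  have hac : ACP J (fun x => p.eval x * gd k x)
      (fun x => (Polynomial.derivative p).eval x * gd k x + p.eval x * gd (k + 1) x) :=
    ACP.mul hJo hJ (ACP.of_hasDerivAt hJ (fun x _ => p.hasDerivAt x)
      (Polynomial.continuous _).continuousOn) (hAC k (by omega))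
  have h1 := hpol (k + 1) p (by omega)
  have hdeg := Polynomial.natDegree_derivative_le p
  have h2 : Integrable (fun x => pq δ β γ x *
      ((Polynomial.derivative p).eval x * (pq δ β γ x ^ k * f x * gd k x))) := by
    refine int_q_mul hδ hq (fun x hx => by simp [G.wzero x hx]) ?_ ?_
    · exact hpol k _ (by omega)
    · have hX : (Polynomial.X * Polynomial.derivative p).natDegree ≤ 1 + (p.natDegree - 1) :=
        (Polynomial.natDegree_mul_le).trans (add_le_add Polynomial.natDegree_X_le hdeg)
      refine (hpol k (Polynomial.X * Polynomial.derivative p) (by omega)).congr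
        (Eventually.of_forall fun x => ?_)
      simp; ring
  have h12 := h2.add h1
  obtain ⟨hk1, hk2⟩ := Gk.key hJo hJ hne hac (h12.congr (Eventually.of_forall fun x => by
    simp only [Pi.add_apply]; ring))
  have e1 : (fun x => pq δ β γ x * (pq δ β γ x ^ k * f x) *
      ((Polynomial.derivative p).eval x * gd k x + p.eval x * gd (k + 1) x)) =
      fun x => pq δ β γ x *
      ((Polynomial.derivative p).eval x * (pq δ β γ x ^ k * f x * gd k x)) +
      p.eval x * (pq δ β γ x ^ (k + 1) * f x * gd (k + 1) x) := by
    funext x; ring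
  rw [e1, integral_add h2 h1] at hk2
  have e2 : (fun x => (Dp μ δ β γ k p).eval x * (pq δ β γ x ^ k * f x * gd k x)) =
      fun x => -((μ + k * β - (1 - 2 * k * δ) * x) * (pq δ β γ x ^ k * f x) * (p.eval x * gd k x))
        - pq δ β γ x *
      ((Polynomial.derivative p).eval x * (pq δ β γ x ^ k * f x * gd k x)) := by
    funext x
    simp [Dp, LinP, Qp_eval]
    ring
  rw [e2, integral_sub hk1.fun_neg h2, integral_neg]
  linarith

/-- Iterated adjoint polynomials. -/
def Sp (μ δ β γ : ℝ) (i : ℕ) : ℕ → Polynomial ℝ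
  | 0 => 1
  | j + 1 => Dp μ δ β γ (i - 1 - j) (Sp μ δ β γ i j)

theorem Sp_deg (μ δ β γ : ℝ) (i j : ℕ) (hj : j ≤ i) : (Sp μ δ β γ i j).natDegree ≤ j ∧
    (Sp μ δ β γ i j).coeff j = ∏ l ∈ Finset.range j, (1 - (2 * (i : ℝ) - 2 - l) * δ) := by
  induction j with
  | zero => simp [Sp]
  | succ j ih =>
    obtain ⟨h1, h2⟩ := ih (by omega)
    obtain ⟨h3, h4⟩ := Dp_deg μ δ β γ (i - 1 - j) _ j h1
    refine ⟨h3, ?_⟩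
    rw [Sp, h4, h2, Finset.prod_range_succ, mul_comm]
    congr 1
    have : ((i - 1 - j : ℕ) : ℝ) = (i : ℝ) - 1 - j := by
      rw [Nat.cast_sub (by omega), Nat.cast_sub (by omega)]; simp
    rw [this]; ring

theorem Sp_coeff_self (μ δ β γ : ℝ) (i : ℕ) :
    (Sp μ δ β γ i i).coeff i = pp δ ((i : ℝ) - 1) i := by
  rw [(Sp_deg μ δ β γ i i le_rfl).2, pp, ← Finset.prod_range_reflect]
  refine Finset.prod_congr rfl fun l hl => ?_
  have hl := Finset.mem_range.1 hl
  have : ((i - 1 - l : ℕ) : ℝ) = (i : ℝ) - 1 - l := by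
    rw [Nat.cast_sub (by omega), Nat.cast_sub (by omega)]; simp
  rw [this]; ring

theorem identS {δ β γ : ℝ} (hδ : δ ≤ 0) {J : Set ℝ} (hJo : IsOpen J) (hJ : J.OrdConnected)
    (hne : J.Nonempty) (hq : ∀ x ∈ J, 0 < pq δ β γ x) {f : ℝ → ℝ} {μ : ℝ}
    (G : GP J (pq δ β γ) f μ 1) {m : ℕ} {gd : ℕ → ℝ → ℝ}
    (hAC : ∀ k < m, ACP J (gd k) (gd (k + 1)))
    (hI : ∀ k ≤ m, Integrable (fun x => pq δ β γ x ^ k * f x * gd k x))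
    (i : ℕ) (hi : i ≤ m) :
    ∫ x, pq δ β γ x ^ i * f x * gd i x = ∫ x, (Sp μ δ β γ i i).eval x * (f x * gd 0 x) := by
  have main : ∀ j ≤ i, ∫ x, pq δ β γ x ^ i * f x * gd i x =
      ∫ x, (Sp μ δ β γ i j).eval x * (pq δ β γ x ^ (i - j) * f x * gd (i - j) x) := by
    intro j
    induction j with
    | zero => intro _; simp [Sp]
    | succ j ih =>
      intro hj
      rw [ih (by omega)]
      have hd := (Sp_deg μ δ β γ i j (by omega)).1
      have := identI hδ hJo hJ hne hq G hAC hI (i - 1 - j) (Sp μ δ β γ i j) (by omega)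
      rw [show i - j = i - 1 - j + 1 by omega, this, show i - (j + 1) = i - 1 - j by omega, Sp]
  have := main i le_rfl
  simpa using this

/-! ### Bessel inequality -/

theorem bessel_abs {P : Measure ℝ} [IsProbabilityMeasure P] {g : ℝ → ℝ} (hg : MemLp g 2 P)
    (R : ℕ → ℝ → ℝ) (hR : ∀ i, MemLp (R i) 2 P) (N : ℕ → ℝ) (m : ℕ)
    (h0 : ∀ i ∈ Finset.Icc 1 m, ∫ x, R i x ∂P = 0)
    (horth : ∀ i ∈ Finset.Icc 1 m, ∀ j ∈ Finset.Icc 1 m,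
      ∫ x, R i x * R j x ∂P = if i = j then N i else 0) :
    ∑ i ∈ Finset.Icc 1 m, (∫ x, R i x * g x ∂P) ^ 2 / N i ≤ variance g P := by
  set A : ℕ → ℝ := fun i => ∫ x, R i x * g x ∂P with hA
  set c : ℕ → ℝ := fun i => A i / N i with hc
  have hcR : ∀ i ∈ Finset.Icc 1 m, MemLp (fun x => c i * R i x) 2 P :=
    fun i _ => (hR i).const_mul _
  set S : ℝ → ℝ := ∑ i ∈ Finset.Icc 1 m, fun x => c i * R i x with hS
  have hSm : MemLp S 2 P := memLp_finsetSum' _ hcR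
  have hv := variance_sub hg hSm
  have hnn := variance_nonneg (g - S) P
  have e1 : cov[g, S; P] = ∑ i ∈ Finset.Icc 1 m, A i ^ 2 / N i := by
    rw [hS, covariance_sum_right' hcR hg]
    refine Finset.sum_congr rfl fun i hi => ?_
    rw [covariance_const_mul_right, covariance_eq_sub hg (hR i), h0 i hi]
    have : ∫ x, (g * R i) x ∂P = A i := by
      simp only [hA, Pi.mul_apply, mul_comm]
    rw [this, hc]; ring
  have e2 : variance S P = ∑ i ∈ Finset.Icc 1 m, A i ^ 2 / N i := by
    rw [← covariance_self hSm.aestronglyMeasurable.aemeasurable, hS,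
      covariance_sum_sum' hcR hcR]
    refine Finset.sum_congr rfl fun i hi => ?_
    have : ∀ j ∈ Finset.Icc 1 m, cov[fun x => c i * R i x, fun x => c j * R j x; P] =
        if i = j then A i ^ 2 / N i else 0 := by
      intro j hj
      rw [covariance_const_mul_right, covariance_const_mul_left, covariance_eq_sub (hR i) (hR j),
        h0 i hi]
      have h3 : ∫ x, (R i * R j) x ∂P = if i = j then N i else 0 := horth i hi j hj
      rw [h3]
      split_ifs with h
      · subst h
        by_cases hN : N i = 0
        · simp [hN]
        · simp only [hc]; field_simp; ring
      · simp
    rw [Finset.sum_congr rfl this, Finset.sum_ite_eq, if_pos hi]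
  rw [e1, e2] at hv
  linarith

theorem iter_deriv_top (r : Polynomial ℝ) (i : ℕ) (hr : r.natDegree ≤ i) (x : ℝ) :
    ((Polynomial.derivative)^[i] r).eval x = (i.factorial : ℝ) * r.coeff i := by
  have hd : ((Polynomial.derivative)^[i] r).natDegree ≤ 0 :=
    (Polynomial.natDegree_iterate_derivative r i).trans (by omega)
  rw [Polynomial.eq_C_of_natDegree_le_zero hd, Polynomial.eval_C,
    Polynomial.coeff_iterate_derivative]
  simp [Nat.descFactorial_self]

theorem orthS {δ β γ : ℝ} (hδ : δ ≤ 0) {J : Set ℝ} (hJo : IsOpen J) (hJ : J.OrdConnected)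
    (hne : J.Nonempty) (hq : ∀ x ∈ J, 0 < pq δ β γ x) {f : ℝ → ℝ} {μ : ℝ}
    (G : GP J (pq δ β γ) f μ 1) (i : ℕ) (r : Polynomial ℝ) (hr : r.natDegree ≤ i) :
    ∫ x, (Sp μ δ β γ i i).eval x * (f x * r.eval x) =
      (i.factorial : ℝ) * r.coeff i * ∫ x, pq δ β γ x ^ i * f x := by
  have hM := G.moments hδ hJo hJ hne hq
  have hP : ∀ p : Polynomial ℝ, Integrable (fun x => p.eval x * f x) := fun p =>
    int_poly (n := p.natDegree) (fun d _ => hM d) p le_rfl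
  have := identS hδ hJo hJ hne hq G (m := i)
    (gd := fun k x => ((Polynomial.derivative)^[k] r).eval x) ?_ ?_ i le_rfl
  · simp only [Function.iterate_zero, id_eq] at this
    rw [← this]
    simp_rw [iter_deriv_top r i hr]
    rw [integral_mul_const]; ring
  · intro k _
    refine ACP.of_hasDerivAt hJ (fun x _ => ?_) (Polynomial.continuous _).continuousOn
    simp only [Function.iterate_succ_apply']
    exact Polynomial.hasDerivAt _ x
  · intro k _
    refine (hP (Qp δ β γ ^ k * (Polynomial.derivative)^[k] r)).congr
      (Eventually.of_forall fun x => ?_)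
    simp [Qp_eval]; ring

/-! ### Set-up from the hypotheses -/

theorem erealIoo_open (α ω : EReal) : IsOpen (erealIoo α ω) :=
  (isOpen_Ioo (a := α) (b := ω)).preimage continuous_coe_real_ereal

theorem erealIoo_ord (α ω : EReal) : (erealIoo α ω).OrdConnected := by
  refine ⟨fun x hx y hy z hz => ⟨hx.1.trans_le ?_, lt_of_le_of_lt ?_ hy.2⟩⟩
  · exact EReal.coe_le_coe_iff.2 hz.1
  · exact EReal.coe_le_coe_iff.2 hz.2

theorem pq_root_finite {δ β γ : ℝ} (h : 0 < |δ| + |β| + |γ|) : {x | pq δ β γ x = 0}.Finite := by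
  have hQ : Qp δ β γ ≠ 0 := by
    intro h0
    have c0 : (Qp δ β γ).coeff 0 = 0 := by rw [h0]; simp
    have c1 : (Qp δ β γ).coeff 1 = 0 := by rw [h0]; simp
    have c2 : (Qp δ β γ).coeff 2 = 0 := by rw [h0]; simp
    simp [Qp, Polynomial.coeff_X, Polynomial.coeff_C, Polynomial.coeff_X_pow] at c0 c1 c2
    simp [c0, c1, c2] at h
  have := Polynomial.finite_setOf_isRoot hQ
  refine this.subset fun x hx => ?_
  simpa [Polynomial.IsRoot, Qp_eval] using hx

theorem f_aesm {f : ℝ → ℝ} {μ δ β γ : ℝ} {J : Set ℝ} (hJo : IsOpen J)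
    (hfpos : ∀ x ∈ J, 0 < f x) (hfzero : ∀ x ∉ J, f x = 0) (h : 0 < |δ| + |β| + |γ|)
    (hiic : ∀ x : ℝ, (∫ t in Set.Iic x, (μ - t) * f t) = pq δ β γ x * f x) :
    AEMeasurable f := by
  have hfin := pq_root_finite h
  set v : ℝ → ℝ := fun t => (μ - t) * f t with hv
  have h1 : ∀ x ∈ J, pq δ β γ x ≠ 0 → IntegrableOn v (Set.Iic x) := by
    intro x hx hqx
    by_contra hni
    have := hiic x
    rw [integral_undef hni] at this
    exact mul_ne_zero hqx (hfpos x hx).ne' this.symm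
  let D : Set ℚ := {r | (r : ℝ) ∈ J ∧ pq δ β γ r ≠ 0}
  have h2 : AEStronglyMeasurable v (volume.restrict (⋃ r : D, Set.Iic ((r : ℚ) : ℝ))) :=
    AEStronglyMeasurable.iUnion fun r => (h1 _ r.2.1 r.2.2).aestronglyMeasurable
  have hsub : J ⊆ ⋃ r : D, Set.Iic ((r : ℚ) : ℝ) := by
    intro y hy
    have hopen : IsOpen (J \ {x | pq δ β γ x = 0}) := hJo.sdiff hfin.isClosed
    have hnear : ∃ z, y < z ∧ z ∈ J \ {x | pq δ β γ x = 0} := by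
      have e1 : ∀ᶠ z in nhdsWithin y (Set.Ioi y), z ∈ J :=
        mem_nhdsWithin_of_mem_nhds (hJo.mem_nhds hy)
      obtain ⟨u, hu, hsubu⟩ := (mem_nhdsGT_iff_exists_Ioo_subset).1 e1
      have hinf : (Set.Ioo y u).Infinite := Set.Ioo_infinite hu
      obtain ⟨z, hz, hz2⟩ := (hinf.diff hfin).nonempty
      exact ⟨z, hz.1, hsubu hz, hz2⟩
    obtain ⟨z, hyz, hz⟩ := hnear
    obtain ⟨r, hr⟩ := Rat.denseRange_cast.exists_mem_open
      (hopen.inter (isOpen_Ioi (a := y))) ⟨z, hz, hyz⟩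
    exact Set.mem_iUnion.2 ⟨⟨r, hr.1.1, hr.1.2⟩, Set.mem_Iic.2 (le_of_lt (Set.mem_Ioi.1 hr.2))⟩
  have h3 : AEStronglyMeasurable v (volume.restrict J) := h2.mono_measure
    (Measure.restrict_mono hsub le_rfl)
  have h4 : AEStronglyMeasurable v := by
    rw [← aestronglyMeasurable_indicator_iff hJo.measurableSet] at h3
    refine h3.congr (Eventually.of_forall fun x => ?_)
    by_cases hx : x ∈ J
    · simp [hx]
    · simp [hx, hv, hfzero x hx]
  have h5 : AEMeasurable (fun t => (μ - t)⁻¹ * v t) :=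
    ((measurable_const.sub measurable_id).inv.aemeasurable).mul h4.aemeasurable
  refine h5.congr ?_
  have hne : ∀ᵐ t : ℝ, t ≠ μ := by simp [ae_iff, measure_singleton]
  filter_upwards [hne] with t ht
  have : μ - t ≠ 0 := sub_ne_zero.2 ht.symm
  simp only [hv]
  field_simp

theorem pq_pos {f : ℝ → ℝ} {μ δ β γ : ℝ} (hδ : δ ≤ 0) {J : Set ℝ} (hJo : IsOpen J)
    (hfpos : ∀ x ∈ J, 0 < f x) (hfnn : ∀ x, 0 ≤ f x) (h : 0 < |δ| + |β| + |γ|)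
    (hint : Integrable (fun t => (μ - t) * f t)) (htot : ∫ t, (μ - t) * f t = 0)
    (hiic : ∀ x : ℝ, (∫ t in Set.Iic x, (μ - t) * f t) = pq δ β γ x * f x) :
    ∀ x ∈ J, 0 < pq δ β γ x := by
  have hnn : ∀ x ∈ J, 0 ≤ pq δ β γ x := by
    intro x hx
    have hW : 0 ≤ pq δ β γ x * f x := by
      rw [← hiic]
      rcases le_total x μ with hle | hle
      · refine setIntegral_nonneg measurableSet_Iic fun t ht => ?_
        exact mul_nonneg (by have := Set.mem_Iic.1 ht; linarith) (hfnn t)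
      · have h1 := integral_add_compl (measurableSet_Iic (a := x)) hint
        have h2 : ∫ t in (Set.Iic x)ᶜ, (μ - t) * f t ≤ 0 := by
          refine setIntegral_nonpos measurableSet_Iic.compl fun t ht => ?_
          have : x < t := not_le.1 ht
          exact mul_nonpos_of_nonpos_of_nonneg (by linarith) (hfnn t)
        linarith
    exact nonneg_of_mul_nonneg_left hW (hfpos x hx)
  intro x hx
  refine lt_of_le_of_ne (hnn x hx) fun h0 => ?_
  obtain ⟨ε, hε, hsub⟩ := Metric.isOpen_iff.1 hJo x hx
  have h1 := hnn (x - ε / 2) (hsub (by simp [abs_of_pos hε]; linarith))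
  have h2 := hnn (x + ε / 2) (hsub (by simp [abs_of_pos hε]; linarith))
  unfold pq at h0 h1 h2
  have hδ0 : δ = 0 := by
    have h3 : 0 ≤ δ * (ε ^ 2 / 2) := by nlinarith
    have h4 := nonneg_of_mul_nonneg_left h3 (by positivity)
    linarith
  subst hδ0
  have hβ0 : β = 0 := by
    have h3 : 0 ≤ β * (ε / 2) := by nlinarith
    have h4 : 0 ≤ -β * (ε / 2) := by nlinarith
    have := nonneg_of_mul_nonneg_left h3 (by positivity)
    have := nonneg_of_mul_nonneg_left h4 (by positivity)
    linarith
  subst hβ0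
  have : γ = 0 := by linarith
  subst this
  simp at h

/-- **Bessel-type lower variance bound.** If `X ∼ IP(μ; δ, β, γ)` with `δ ≤ 0`,
`m ≥ 1` and `g ∈ H^{m,0}(X)`, then
`Var g(X) ≥ Σ_{i=1}^{m} (E q(X)^i g^{(i)}(X))² / (i! E q(X)^i ∏_{j=i−1}^{2i−2}(1−jδ))`. -/
theorem pearson_bessel_bound
    (P : Measure ℝ) (f : ℝ → ℝ) (μ δ β γ : ℝ) (hδ : δ ≤ 0)
    (hIP : IsIntegratedPearson P f μ δ β γ)
    (α ω : EReal) (hsupp : {x : ℝ | 0 < f x} = erealIoo α ω)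
    (m : ℕ) (hm : 1 ≤ m) (gd : ℕ → ℝ → ℝ)
    (hg : MemH P (pq δ β γ) (erealIoo α ω) m 0 gd) :
    variance (gd 0) P ≥
      ∑ i ∈ Finset.Icc 1 m,
        (∫ x, pq δ β γ x ^ i * gd i x ∂P) ^ 2 /
          ((i.factorial : ℝ) * (∫ x, pq δ β γ x ^ i ∂P) * pp δ ((i : ℝ) - 1) i) := by
  obtain ⟨hprob, hfnn, hPd, hPx, hμ, habs, hiic⟩ := hIP
  obtain ⟨hg1, hg2, hg3, hg4, hg5⟩ := hg
  have hJo := erealIoo_open α ω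
  have hJ := erealIoo_ord α ω
  generalize erealIoo α ω = J at *
  rw [Nat.max_zero] at hg1 hg2 hg3
  have hfpos : ∀ x ∈ J, 0 < f x := fun x hx => by rw [← hsupp] at hx; exact hx
  have hfzero : ∀ x ∉ J, f x = 0 := fun x hx => by
    rw [← hsupp] at hx
    exact le_antisymm (not_lt.1 hx) (hfnn x)
  have hfm : AEMeasurable f := f_aesm hJo hfpos hfzero habs hiic
  have hfm' : AEMeasurable (fun x => ENNReal.ofReal (f x)) := hfm.ennreal_ofReal
  have hlt : ∀ᵐ x : ℝ, ENNReal.ofReal (f x) < ⊤ := Eventually.of_forall fun x => by simp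
  have trI : ∀ φ : ℝ → ℝ, Integrable φ P ↔ Integrable (fun x => f x * φ x) := fun φ => by
    rw [hPd, integrable_withDensity_iff_integrable_smul₀' hfm' hlt]
    simp [ENNReal.toReal_ofReal (hfnn _)]
  have trE : ∀ φ : ℝ → ℝ, ∫ x, φ x ∂P = ∫ x, f x * φ x := fun φ => by
    rw [hPd, integral_withDensity_eq_integral_toReal_smul₀ hfm' hlt]
    simp [ENNReal.toReal_ofReal (hfnn _)]
  have int0 : Integrable f := by simpa using (trI (fun _ => 1)).1 (integrable_const _)
  have int1 : Integrable (fun x => x * f x) := by simpa [mul_comm] using (trI (fun x => x)).1 hPx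
  have tot0 : ∫ x, f x = 1 := by
    have := trE (fun _ => 1)
    simpa using this.symm
  have tot1 : ∫ x, x * f x = μ := by
    rw [hμ, trE]; simp only [mul_comm]
  have intL : Integrable (fun t => (μ - t) * f t) := by
    refine ((int0.const_mul μ).sub int1).congr (Eventually.of_forall fun x => ?_)
    simp only [Pi.sub_apply]; ring
  have htot : ∫ t, (μ - t) * f t = 0 := by
    have e : (fun t => (μ - t) * f t) = fun t => μ * f t - t * f t := by funext t; ring
    rw [e, integral_sub (int0.const_mul μ) int1, integral_const_mul, tot0, tot1]; ring
  have hne : J.Nonempty := by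
    by_contra hem
    rw [Set.not_nonempty_iff_eq_empty] at hem
    have : ∀ x, f x = 0 := fun x => hfzero x (by simp [hem])
    simp [this] at tot0
  have hq := pq_pos hδ hJo hfpos hfnn habs intL htot hiic
  have G : GP J (pq δ β γ) f μ 1 :=
    ⟨one_pos, hfpos, hfzero, int0, int1, by simpa using htot, by simpa using hiic⟩
  have hcont : ∀ k < m, ContinuousOn (gd k) J := by
    intro k hk
    by_cases h : k + 1 < m
    · exact fun x hx => (hg1 k h x hx).continuousAt.continuousWithinAt
    · have : k = m - 1 := by omega
      rw [this]; exact hg2 hm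
  have hAC : ∀ k < m, ACP J (gd k) (gd (k + 1)) := by
    intro k hk
    by_cases h : k + 1 < m
    · exact ACP.of_hasDerivAt hJ (hg1 k h) (hcont _ h)
    · refine ⟨?_⟩
      have h1 : k = m - 1 := by omega
      have h2 : k + 1 = m := by omega
      rw [h2, h1]; exact hg3 hm
  have hmeas : ∀ k ≤ m, AEStronglyMeasurable (J.indicator (gd k)) volume := by
    intro k hk
    rw [aestronglyMeasurable_indicator_iff hJo.measurableSet]
    rcases k with _ | k
    · exact (hcont 0 (by omega)).aestronglyMeasurable hJo.measurableSet
    · exact (hAC k (by omega)).aesm hJo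
  have hPJ : ∀ᵐ x ∂P, x ∈ J := by
    have h1 : AEMeasurable (J.indicator (fun _ => (1 : ℝ))) P :=
      (measurable_const.indicator hJo.measurableSet).aemeasurable
    rw [hPd, ae_withDensity_iff' hfm']
    refine Eventually.of_forall fun x hx => ?_
    by_contra hxJ
    simp [hfzero x hxJ] at hx
  have hPac : P ≪ volume := by rw [hPd]; exact withDensity_absolutelyContinuous _ _
  have hgm : AEStronglyMeasurable (gd 0) P := by
    refine ((hmeas 0 (by omega)).mono_ac hPac).congr ?_
    filter_upwards [hPJ] with x hx
    simp [hx]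
  have hgL2 : MemLp (gd 0) 2 P := by
    rw [memLp_two_iff_integrable_sq hgm]
    simpa using hg4
  have hI : ∀ k ≤ m, Integrable (fun x => pq δ β γ x ^ k * f x * gd k x) := by
    intro k hk
    rcases Nat.eq_zero_or_pos k with rfl | hk0
    · have := (trI _).1 (hgL2.integrable (by norm_num))
      simpa using this
    · have h1 := (trI _).1 (hg5 k hk0 hk)
      have hms : AEStronglyMeasurable (fun x => pq δ β γ x ^ k * f x * gd k x) volume := by
        have h2 := ((((pq_cont δ β γ).pow k).aestronglyMeasurable (μ := volume)).mul
          hfm.aestronglyMeasurable).mul (hmeas k hk)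
        refine h2.congr (Eventually.of_forall fun x => ?_)
        by_cases hx : x ∈ J
        · simp [hx]
        · simp [hx, hfzero x hx]
      refine h1.mono hms (Eventually.of_forall fun x => le_of_eq ?_)
      simp only [norm_mul, Real.norm_eq_abs, abs_abs]
      ring
  have hM := G.moments hδ hJo hJ hne hq
  have hP : ∀ p : Polynomial ℝ, Integrable (fun x => p.eval x * f x) := fun p =>
    int_poly (n := p.natDegree) (fun d _ => hM d) p le_rfl
  set R : ℕ → Polynomial ℝ := fun i => Sp μ δ β γ i i with hR
  have hRdeg : ∀ i, (R i).natDegree ≤ i := fun i => (Sp_deg μ δ β γ i i le_rfl).1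
  have hRL2 : ∀ i, MemLp (fun x => (R i).eval x) 2 P := by
    intro i
    rw [memLp_two_iff_integrable_sq (R i).continuous.aestronglyMeasurable, trI]
    refine (hP (R i ^ 2)).congr (Eventually.of_forall fun x => ?_)
    simp; ring
  have hRr : ∀ i (r : Polynomial ℝ), r.natDegree ≤ i →
      ∫ x, (R i).eval x * r.eval x ∂P =
        (i.factorial : ℝ) * r.coeff i * ∫ x, pq δ β γ x ^ i ∂P := by
    intro i r hr
    rw [trE, trE]
    have := orthS hδ hJo hJ hne hq G i r hr
    calc _ = ∫ x, (R i).eval x * (f x * r.eval x) := by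
          congr 1; funext x; ring
      _ = _ := this
      _ = _ := by simp only [mul_comm (f _)]
  have hlt0 : ∀ i (r : Polynomial ℝ), r.natDegree < i →
      ∫ x, (R i).eval x * r.eval x ∂P = 0 := by
    intro i r hr
    rw [hRr i r hr.le, Polynomial.coeff_eq_zero_of_natDegree_lt hr]; ring
  have hB := bessel_abs hgL2 (fun i x => (R i).eval x) hRL2
    (fun i => (i.factorial : ℝ) * (∫ x, pq δ β γ x ^ i ∂P) * pp δ ((i : ℝ) - 1) i) m ?_ ?_
  · refine le_trans (le_of_eq ?_) hB
    refine Finset.sum_congr rfl fun i hi => ?_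
    have him := (Finset.mem_Icc.1 hi).2
    have h1 := identS hδ hJo hJ hne hq G hAC hI i him
    congr 2
    rw [trE, trE]
    calc _ = ∫ x, pq δ β γ x ^ i * f x * gd i x := by congr 1; funext x; ring
      _ = _ := h1
      _ = _ := by congr 1; funext x; ring
  · intro i hi
    have hi1 := (Finset.mem_Icc.1 hi).1
    have := hlt0 i 1 (by rw [Polynomial.natDegree_one]; omega)
    simpa using this
  · intro i _ j _
    split_ifs with hij
    · subst hij
      have := hRr i (R i) (hRdeg i)
      rw [this, hR]
      simp only [Sp_coeff_self]
      ring
    · rcases lt_or_gt_of_ne hij with h | h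
      · have := hlt0 j (R i) (lt_of_le_of_lt (hRdeg i) h)
        simpa [mul_comm] using this
      · exact hlt0 i (R j) (lt_of_le_of_lt (hRdeg j) h)

end
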